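/- Let S be a finite semigroup and m ≥ 1 an integer with S^m = S^{m+1}. Then S^m = SES, i.e. an element of S lies in S^m if and only if it can be written as xey with x, y ∈ S and e an idempotent of S. -/

import Mathlib

universe u

/-- Product of a list of semigroup elements, computed in `WithOne S`
(the empty list gives `1`). -/
def listSProd {S : Type u} [Semigroup S] (l : List S) : WithOne S :=
  (l.map (fun a => (a : WithOne S))).prod

/-- `SPow S m` : the set of elements of `S` that are products of `m` or more
elements of `S`. -/
def SPow (S : Type u) [Semigroup S] (m : ℕ) : Set S :=
  {x | ∃ l : List S, m ≤ l.length ∧ listSProd l = (x : WithOne S)}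

/-- `SES S` : the set of elements of the form `x * e * y` with `e` idempotent. -/
def SES (S : Type u) [Semigroup S] : Set S :=
  {s | ∃ x e y : S, e * e = e ∧ s = x * e * y}

/-- positive powers in a semigroup: `ppow a k = a ^ (k+1)`. -/
def ppow {S : Type u} [Semigroup S] (a : S) : ℕ → S
  | 0 => a
  | k + 1 => ppow a k * a

/-- `u` and `v` have the same set of factors (contiguous subwords) of length `k`. -/
def SameFactors {α : Type u} (k : ℕ) (u v : List α) : Prop :=
  ∀ x : List α, x.length = k →
    ((∃ p q : List α, u = p ++ x ++ q) ↔ (∃ p q : List α, v = p ++ x ++ q))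

/-- `φ` identifies any two nonempty words with the same prefix of length `ps`,
the same suffix of length `ps` and the same set of factors of length `k`. -/
def TestableFor {α S : Type u} [Semigroup S] (ps k : ℕ) (φ : List α → S) : Prop :=
  ∀ u v : List α, u ≠ [] → v ≠ [] →
    u.take ps = v.take ps →
    u.drop (u.length - ps) = v.drop (v.length - ps) →
    SameFactors k u v →
    φ u = φ v

/-- `φ : List α → S` is a semigroup homomorphism from the free semigroup of
nonempty words over `α` to `S`. -/
def IsSgHom {α S : Type u} [Semigroup S] (φ : List α → S) : Prop :=
  ∀ u v : List α, u ≠ [] → v ≠ [] → φ (u ++ v) = φ u * φ v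

/-- `φ` is surjective on nonempty words. -/
def SurjOnWords {α S : Type u} (φ : List α → S) : Prop :=
  ∀ s : S, ∃ u : List α, u ≠ [] ∧ φ u = s

/-- `S` is `k`-testable. -/
def IsKTestable (S : Type u) [Semigroup S] (k : ℕ) : Prop :=
  ∃ (α : Type u) (φ : List α → S), IsSgHom φ ∧ SurjOnWords φ ∧ TestableFor k k φ

/-- `S` is `k`-testable in the sense of Brzozowski–Simon. -/
def IsKTestableBS (S : Type u) [Semigroup S] (k : ℕ) : Prop :=
  ∃ (α : Type u) (φ : List α → S), IsSgHom φ ∧ SurjOnWords φ ∧ TestableFor (k - 1) k φ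

/-- `S` is locally testable. -/
def LocallyTestable (S : Type u) [Semigroup S] : Prop :=
  ∃ k : ℕ, 1 ≤ k ∧ IsKTestable S k

/-- The identities (2) for parameter `n`. -/
def Ident2 (S : Type u) [Semigroup S] (n : ℕ) : Prop :=
  ∀ r : ℕ, 1 ≤ r → r ≤ n → ∀ x : Fin r → S,
    listSProd (List.ofFn x) ^ ((n - (n - 1) % r - 1) / r + 1)
        * listSProd ((List.ofFn x).take ((n - 1) % r))
      = listSProd (List.ofFn x) ^ ((n - (n - 1) % r - 1) / r + 2)
        * listSProd ((List.ofFn x).take ((n - 1) % r))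

/-- The identity (3) for parameter `n`. -/
def Ident3 (S : Type u) [Semigroup S] (n : ℕ) : Prop :=
  ∀ (t₁ t₂ y z : S) (x : Fin (n - 1) → S),
    (t₁ : WithOne S) * listSProd (List.ofFn x) * y * listSProd (List.ofFn x) * z
        * listSProd (List.ofFn x) * t₂
      = (t₁ : WithOne S) * listSProd (List.ofFn x) * z * listSProd (List.ofFn x) * y
        * listSProd (List.ofFn x) * t₂

/-- The identity (4) for parameter `n`. -/
def Ident4 (S : Type u) [Semigroup S] (n : ℕ) : Prop :=
  ∀ (y z : S) (x : Fin (n - 1) → S),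
    listSProd (List.ofFn x) * y * listSProd (List.ofFn x) * z * listSProd (List.ofFn x)
      = listSProd (List.ofFn x) * z * listSProd (List.ofFn x) * y * listSProd (List.ofFn x)

theorem listSProd_append {S : Type u} [Semigroup S] (l₁ l₂ : List S) :
    listSProd (l₁ ++ l₂) = listSProd l₁ * listSProd l₂ := by
  simp [listSProd]

theorem listSProd_singleton {S : Type u} [Semigroup S] (a : S) :
    listSProd [a] = (a : WithOne S) := by
  simp [listSProd]

theorem exists_coe_eq_listSProd {S : Type u} [Semigroup S] {l : List S} (hl : l ≠ []) :
    ∃ a : S, listSProd l = (a : WithOne S) := by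
  induction l with
  | nil => exact absurd rfl hl
  | cons a l ih =>
    rw [← List.singleton_append, listSProd_append, listSProd_singleton]
    by_cases h : l = []
    · exact ⟨a, by simp [h, listSProd]⟩
    · obtain ⟨b, hb⟩ := ih h
      exact ⟨a * b, by rw [hb, WithOne.coe_mul]⟩

theorem listSProd_replicate_of_idempotent {S : Type u} [Semigroup S] {e : S} (he : e * e = e)
    (n : ℕ) : listSProd (List.replicate (n + 1) e) = (e : WithOne S) := by
  induction n with
  | zero => simp [listSProd]
  | succ n ih =>
    rw [List.replicate_succ, ← List.singleton_append, listSProd_append, ih,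
      listSProd_singleton, ← WithOne.coe_mul, he]

theorem SES_subset_SPow (S : Type u) [Semigroup S] (m : ℕ) : SES S ⊆ SPow S m := by
  rintro _ ⟨x, e, y, he, rfl⟩
  refine ⟨[x] ++ List.replicate (m + 1) e ++ [y], by simp; omega, ?_⟩
  simp only [listSProd_append, listSProd_singleton, listSProd_replicate_of_idempotent he,
    WithOne.coe_mul]

theorem SPow_subset_add {S : Type u} [Semigroup S] {m : ℕ} (hm : 1 ≤ m)
    (h : SPow S m ⊆ SPow S (m + 1)) (k : ℕ) : SPow S m ⊆ SPow S (m + k) := by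
  induction k with
  | zero => exact subset_rfl
  | succ k ih =>
    intro s hs
    obtain ⟨l, hl, hls⟩ := ih hs
    have hlen : (l.take m).length = m := by rw [List.length_take]; omega
    obtain ⟨a, ha⟩ := exists_coe_eq_listSProd (l := l.take m)
      (List.ne_nil_of_length_pos (by omega))
    obtain ⟨l', hl', hla⟩ := h ⟨l.take m, hlen.ge, ha⟩
    refine ⟨l' ++ l.drop m, ?_, ?_⟩
    · rw [List.length_append, List.length_drop]; omega
    · rw [listSProd_append, hla, ← ha, ← listSProd_append, List.take_append_drop, hls]

/-- If `p` is fixed by right multiplication by some element of a finite semigroup, it is fixed by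
right multiplication by some idempotent. -/
theorem exists_idempotent_mul_eq {S : Type u} [Semigroup S] [Finite S] {p q : S}
    (h : p * q = p) : ∃ e : S, e * e = e ∧ p * e = p := by
  let _ : TopologicalSpace S := ⊥
  have : DiscreteTopology S := ⟨rfl⟩
  obtain ⟨e, he, hee⟩ := exists_idempotent_in_compact_subsemigroup
    (fun _ => continuous_of_discreteTopology) {x : S | p * x = p} ⟨q, h⟩
    (Set.toFinite _).isCompact
    (fun x hx y hy => by
      simp only [Set.mem_ofPred_eq] at hx hy ⊢
      rw [← mul_assoc, hx, hy])
  exact ⟨e, hee, he⟩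

theorem SPow_card_add_two_subset_SES (S : Type u) [Semigroup S] [Finite S] :
    SPow S (Nat.card S + 2) ⊆ SES S := by
  rintro s ⟨l, hl, hls⟩
  have hprefix : ∀ i : Fin (Nat.card S + 1),
      ∃ a : S, listSProd (l.take (i + 1)) = (a : WithOne S) := fun i =>
    exists_coe_eq_listSProd (List.ne_nil_of_length_pos (by rw [List.length_take]; omega))
  choose p hp using hprefix
  obtain ⟨i, j, hij, hpij⟩ : ∃ i j, i < j ∧ p i = p j := by
    have hninj : ¬ Function.Injective p := fun hinj => by
      have := Nat.card_le_card_of_injective p hinj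
      simp at this
    obtain ⟨i, j, h, hne⟩ := Function.not_injective_iff.mp hninj
    rcases lt_or_gt_of_ne hne with hlt | hlt
    · exact ⟨i, j, hlt, h⟩
    · exact ⟨j, i, hlt, h.symm⟩
  have hij' : (i : ℕ) < j := hij
  obtain ⟨q, hq⟩ := exists_coe_eq_listSProd (l := (l.drop (i + 1)).take (j - i))
    (List.ne_nil_of_length_pos (by rw [List.length_take, List.length_drop]; omega))
  obtain ⟨r, hr⟩ := exists_coe_eq_listSProd (l := l.drop (i + 1))
    (List.ne_nil_of_length_pos (by rw [List.length_drop]; omega))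
  have hpq : p i * q = p i := by
    apply WithOne.coe_injective
    rw [WithOne.coe_mul, ← hq, ← hp i, ← listSProd_append, ← List.take_add, hp i, hpij, ← hp j]
    congr 2
    omega
  obtain ⟨e, hee, hpe⟩ := exists_idempotent_mul_eq hpq
  refine ⟨p i, e, r, hee, WithOne.coe_injective ?_⟩
  rw [hpe, WithOne.coe_mul, ← hp i, ← hr, ← listSProd_append, List.take_append_drop, hls]

/-- Lemma 2: if `S` is a finite semigroup with `S^m = S^{m+1}`,
then `S^m = SES`. -/
theorem stmt2 {S : Type u} [Semigroup S] [Finite S] (m : ℕ) (hm : 1 ≤ m)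
    (hSm : SPow S m = SPow S (m + 1)) :
    SPow S m = SES S := by
  refine subset_antisymm (fun s hs => ?_) (SES_subset_SPow S m)
  obtain ⟨l, hl, hls⟩ := SPow_subset_add hm hSm.subset (Nat.card S + 2) hs
  exact SPow_card_add_two_subset_SES S ⟨l, by omega, hls⟩
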